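/- The curvature tensor R(X, Y, Z, W) := λ² Σ_{i=1}^{3} Hᵢ(X, Y)·Hᵢ(Z, W) of the canonical connection of n_p is invariant under the holonomy algebra spanned by H₁, H₂, H₃: for each j = 1, 2, 3 and all X, Y, Z, W ∈ n_p, R(HⱼX, Y, Z, W) + R(X, HⱼY, Z, W) + R(X, Y, HⱼZ, W) + R(X, Y, Z, HⱼW) = 0. (This expresses the parallelism ∇R = 0 of the curvature of the canonical connection.) -/

import Mathlib

/-! Common setup: the quaternionic Heisenberg Lie algebra `n_p` of dimension `4p+3`,
realised as `ℝ^{4p+3}` with orthonormal basis `ξ₁ ξ₂ ξ₃ τ₁ … τ_{4p}`. -/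

noncomputable section

open scoped BigOperators

/-- The underlying vector space of the quaternionic Heisenberg Lie algebra `n_p`. -/
abbrev NV (p : ℕ) : Type := Fin (4 * p + 3) → ℝ

/-- The inner product `g_λ` for which the standard basis is orthonormal. -/
def gIP {p : ℕ} (X Y : NV p) : ℝ := ∑ a, X a * Y a

/-- Index of the basis vector `ξ_{i+1}`, `i = 0, 1, 2`. -/
def zI (p : ℕ) (i : Fin 3) : Fin (4 * p + 3) := ⟨i.val, by have := i.isLt; omega⟩

/-- Index of the basis vector `τ_{ip + r + 1}`, `i = 0, 1, 2, 3`, `r = 0, …, p-1`. -/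
def tI (p : ℕ) (i : Fin 4) (r : Fin p) : Fin (4 * p + 3) :=
  ⟨3 + i.val * p + r.val, by
    have h1 := i.isLt; have h2 := r.isLt
    have h3 : i.val * p ≤ 3 * p := Nat.mul_le_mul_right p (by omega)
    omega⟩

/-- The basis vector `ξ_{i+1}`. -/
def xi (p : ℕ) (i : Fin 3) : NV p := Pi.single (zI p i) 1

/-- The basis vector `τ_{ip + r + 1}`. -/
def tau (p : ℕ) (i : Fin 4) (r : Fin p) : NV p := Pi.single (tI p i r) 1

/-- The Lie bracket of `n_p`: the bilinear extension of
`[τ_r, τ_{p+r}] = [τ_{2p+r}, τ_{3p+r}] = λ ξ₁`, `[τ_r, τ_{2p+r}] = [τ_{3p+r}, τ_{p+r}] = λ ξ₂`,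
`[τ_r, τ_{3p+r}] = [τ_{p+r}, τ_{2p+r}] = λ ξ₃`, all other brackets of basis vectors being zero. -/
def bracket (p : ℕ) (lam : ℝ) (X Y : NV p) : NV p :=
  (lam * ∑ r : Fin p,
      (X (tI p 0 r) * Y (tI p 1 r) - X (tI p 1 r) * Y (tI p 0 r)
        + X (tI p 2 r) * Y (tI p 3 r) - X (tI p 3 r) * Y (tI p 2 r))) • xi p 0
  + (lam * ∑ r : Fin p,
      (X (tI p 0 r) * Y (tI p 2 r) - X (tI p 2 r) * Y (tI p 0 r)
        + X (tI p 3 r) * Y (tI p 1 r) - X (tI p 1 r) * Y (tI p 3 r))) • xi p 1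
  + (lam * ∑ r : Fin p,
      (X (tI p 0 r) * Y (tI p 3 r) - X (tI p 3 r) * Y (tI p 0 r)
        + X (tI p 1 r) * Y (tI p 2 r) - X (tI p 2 r) * Y (tI p 1 r))) • xi p 2

/-- `dη_i(X, Y) := -η_i([X, Y])`. -/
def dEta (p : ℕ) (lam : ℝ) (i : Fin 3) (X Y : NV p) : ℝ := -(bracket p lam X Y (zI p i))

/-- The three almost contact endomorphisms `φ₁, φ₂, φ₃` of `n_p`. -/
def phi (p : ℕ) : Fin 3 → NV p → NV p :=
  ![fun X => X (zI p 1) • xi p 2 - X (zI p 2) • xi p 1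
      + ∑ r : Fin p, (X (tI p 0 r) • tau p 1 r - X (tI p 1 r) • tau p 0 r
          + X (tI p 2 r) • tau p 3 r - X (tI p 3 r) • tau p 2 r),
    fun X => X (zI p 2) • xi p 0 - X (zI p 0) • xi p 2
      + ∑ r : Fin p, (X (tI p 0 r) • tau p 2 r - X (tI p 2 r) • tau p 0 r
          + X (tI p 3 r) • tau p 1 r - X (tI p 1 r) • tau p 3 r),
    fun X => X (zI p 0) • xi p 1 - X (zI p 1) • xi p 0
      + ∑ r : Fin p, (X (tI p 0 r) • tau p 3 r - X (tI p 3 r) • tau p 0 r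
          + X (tI p 1 r) • tau p 2 r - X (tI p 2 r) • tau p 1 r)]

/-- `(η_i ∧ η_j)(X, Y)`. -/
def etaWedge (p : ℕ) (i j : Fin 3) (X Y : NV p) : ℝ :=
  X (zI p i) * Y (zI p j) - Y (zI p i) * X (zI p j)

/-- The 2-forms `H₁ = -(1/λ)dη₁ + 2 η₂∧η₃`, `H₂ = -(1/λ)dη₂ - 2 η₁∧η₃`,
`H₃ = -(1/λ)dη₃ + 2 η₁∧η₂`. -/
def Hform (p : ℕ) (lam : ℝ) : Fin 3 → NV p → NV p → ℝ :=
  ![fun X Y => -(1 / lam) * dEta p lam 0 X Y + 2 * etaWedge p 1 2 X Y,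
    fun X Y => -(1 / lam) * dEta p lam 1 X Y - 2 * etaWedge p 0 2 X Y,
    fun X Y => -(1 / lam) * dEta p lam 2 X Y + 2 * etaWedge p 0 1 X Y]

/-- The 2-form `H_i` regarded as an endomorphism of `n_p` via `g_λ(H_i X, Y) = H_i(X, Y)`. -/
def Hend (p : ℕ) (lam : ℝ) (i : Fin 3) (X : NV p) : NV p :=
  fun b => Hform p lam i X (Pi.single b 1)

/-- `(η₁ ∧ η₂ ∧ η₃)(X, Y, Z)`. -/
def det3 (p : ℕ) (X Y Z : NV p) : ℝ :=
  X (zI p 0) * (Y (zI p 1) * Z (zI p 2) - Y (zI p 2) * Z (zI p 1))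
  - Y (zI p 0) * (X (zI p 1) * Z (zI p 2) - X (zI p 2) * Z (zI p 1))
  + Z (zI p 0) * (X (zI p 1) * Y (zI p 2) - X (zI p 2) * Y (zI p 1))

/-- The torsion 3-form `T = η₁∧dη₁ + η₂∧dη₂ + η₃∧dη₃ - 4λ η₁∧η₂∧η₃`. -/
def Tform (p : ℕ) (lam : ℝ) (X Y Z : NV p) : ℝ :=
  (∑ i : Fin 3,
    (X (zI p i) * dEta p lam i Y Z - Y (zI p i) * dEta p lam i X Z
      + Z (zI p i) * dEta p lam i X Y)) - 4 * lam * det3 p X Y Z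

/-- The standard basis vector `e_a` of `n_p`. -/
def basisE (p : ℕ) (a : Fin (4 * p + 3)) : NV p := Pi.single a 1

end

theorem tI_eq_tI_iff {p : ℕ} {i i' : Fin 4} {r r' : Fin p} :
    tI p i r = tI p i' r' ↔ i = i' ∧ r = r' := by
  have hr := r.isLt
  have hr' := r'.isLt
  refine ⟨fun h => ?_, by rintro ⟨rfl, rfl⟩; rfl⟩
  simp only [tI, Fin.mk.injEq] at h
  fin_cases i <;> fin_cases i' <;> simp [Fin.ext_iff] at h ⊢ <;> omega

theorem zI_eq_zI_iff {p : ℕ} {i i' : Fin 3} : zI p i = zI p i' ↔ i = i' := by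
  simp [zI, Fin.ext_iff]

theorem zI_ne_tI {p : ℕ} (i : Fin 3) (k : Fin 4) (r : Fin p) : zI p i ≠ tI p k r := by
  have := i.isLt
  simp only [zI, tI, ne_eq, Fin.mk.injEq]
  omega

theorem single_zI_zI (p : ℕ) (i i' : Fin 3) :
    (Pi.single (zI p i) 1 : NV p) (zI p i') = if i' = i then 1 else 0 := by
  simp [Pi.single_apply, zI_eq_zI_iff]

theorem single_zI_tI (p : ℕ) (i : Fin 3) (k : Fin 4) (r : Fin p) :
    (Pi.single (zI p i) 1 : NV p) (tI p k r) = 0 := by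
  simp [(zI_ne_tI i k r).symm]

theorem single_tI_zI (p : ℕ) (i : Fin 3) (k : Fin 4) (r : Fin p) :
    (Pi.single (tI p k r) 1 : NV p) (zI p i) = 0 := by
  simp [zI_ne_tI i k r]

theorem single_tI_tI (p : ℕ) (k k' : Fin 4) (r r' : Fin p) :
    (Pi.single (tI p k r) 1 : NV p) (tI p k' r') =
      if k' = k then if r' = r then 1 else 0 else 0 := by
  simp [Pi.single_apply, tI_eq_tI_iff, ite_and]

/-- The forms `H_i` in coordinates; they do not depend on `λ`. -/
theorem Hform_eq {p : ℕ} {lam : ℝ} (hlam : lam ≠ 0) (i : Fin 3) (X Y : NV p) :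
    Hform p lam i X Y =
      ![∑ r : Fin p, (X (tI p 0 r) * Y (tI p 1 r) - X (tI p 1 r) * Y (tI p 0 r)
          + X (tI p 2 r) * Y (tI p 3 r) - X (tI p 3 r) * Y (tI p 2 r))
          + 2 * (X (zI p 1) * Y (zI p 2) - X (zI p 2) * Y (zI p 1)),
        ∑ r : Fin p, (X (tI p 0 r) * Y (tI p 2 r) - X (tI p 2 r) * Y (tI p 0 r)
          + X (tI p 3 r) * Y (tI p 1 r) - X (tI p 1 r) * Y (tI p 3 r))
          + 2 * (X (zI p 2) * Y (zI p 0) - X (zI p 0) * Y (zI p 2)),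
        ∑ r : Fin p, (X (tI p 0 r) * Y (tI p 3 r) - X (tI p 3 r) * Y (tI p 0 r)
          + X (tI p 1 r) * Y (tI p 2 r) - X (tI p 2 r) * Y (tI p 1 r))
          + 2 * (X (zI p 0) * Y (zI p 1) - X (zI p 1) * Y (zI p 0))] i := by
  fin_cases i <;>
    simp [Hform, dEta, bracket, xi, single_zI_zI, etaWedge, hlam] <;> ring

theorem Hend_zI {p : ℕ} {lam : ℝ} (hlam : lam ≠ 0) (j k : Fin 3) (X : NV p) :
    Hend p lam j X (zI p k) =
      !![0, -2 * X (zI p 2), 2 * X (zI p 1);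
         2 * X (zI p 2), 0, -2 * X (zI p 0);
         -2 * X (zI p 1), 2 * X (zI p 0), 0] j k := by
  fin_cases j <;> fin_cases k <;>
    simp [Hend, Hform_eq hlam, single_zI_zI, single_zI_tI]

theorem Hend_tI {p : ℕ} {lam : ℝ} (hlam : lam ≠ 0) (j : Fin 3) (k : Fin 4) (r : Fin p) (X : NV p) :
    Hend p lam j X (tI p k r) =
      !![-X (tI p 1 r), X (tI p 0 r), -X (tI p 3 r), X (tI p 2 r);
         -X (tI p 2 r), X (tI p 3 r), X (tI p 0 r), -X (tI p 1 r);
         -X (tI p 3 r), -X (tI p 2 r), X (tI p 1 r), X (tI p 0 r)] j k := by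
  fin_cases j <;> fin_cases k <;>
    simp [Hend, Hform_eq hlam, single_tI_zI, single_tI_tI]

/-- The endomorphisms `H_j` act on the span of the forms `H_i` as on `so(3)`. -/
theorem Hform_Hend_add {p : ℕ} {lam : ℝ} (hlam : lam ≠ 0) (i j : Fin 3) (X Y : NV p) :
    Hform p lam i (Hend p lam j X) Y + Hform p lam i X (Hend p lam j Y) =
      2 * !![0, Hform p lam 2 X Y, -Hform p lam 1 X Y;
             -Hform p lam 2 X Y, 0, Hform p lam 0 X Y;
             Hform p lam 1 X Y, -Hform p lam 0 X Y, 0] i j := by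
  fin_cases i <;> fin_cases j <;>
    simp [Hform_eq hlam, Hend_zI hlam, Hend_tI hlam, Finset.sum_add_distrib,
      Finset.sum_sub_distrib] <;> ring

/-- the curvature tensor `R(X,Y,Z,W) = λ² Σᵢ Hᵢ(X,Y)·Hᵢ(Z,W)` of the canonical
connection is invariant under the holonomy algebra spanned by `H₁, H₂, H₃`
(this expresses `∇R = 0`). -/
theorem quaternionic_heisenberg_curvature_holonomy_invariant
    (p : ℕ) (hp : 1 ≤ p) (lam : ℝ) (hlam : 0 < lam) :
    ∀ j : Fin 3, ∀ X Y Z W : NV p,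
      (lam ^ 2 * ∑ i : Fin 3, Hform p lam i (Hend p lam j X) Y * Hform p lam i Z W)
        + (lam ^ 2 * ∑ i : Fin 3, Hform p lam i X (Hend p lam j Y) * Hform p lam i Z W)
        + (lam ^ 2 * ∑ i : Fin 3, Hform p lam i X Y * Hform p lam i (Hend p lam j Z) W)
        + (lam ^ 2 * ∑ i : Fin 3, Hform p lam i X Y * Hform p lam i Z (Hend p lam j W)) = 0 := by
  intro j X Y Z W
  have hXY (i : Fin 3) := Hform_Hend_add hlam.ne' i j X Y
  have hZW (i : Fin 3) := Hform_Hend_add hlam.ne' i j Z W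
  calc
    _ = lam ^ 2 * ∑ i : Fin 3,
        ((Hform p lam i (Hend p lam j X) Y + Hform p lam i X (Hend p lam j Y)) * Hform p lam i Z W
          + Hform p lam i X Y
            * (Hform p lam i (Hend p lam j Z) W + Hform p lam i Z (Hend p lam j W))) := by
      simp only [Fin.sum_univ_three]
      ring
    _ = 0 := by
      simp only [hXY, hZW]
      refine mul_eq_zero_of_right _ ?_
      fin_cases j <;> simp [Fin.sum_univ_three] <;> ring
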